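/- arXiv:math/0204010 — 7 statements merged into one kernel-verified Lean document; each statement's English description precedes it below -/
import Mathlib

section
/- Under axiom [C5] and the Leibniz rule (L), the bracket satisfies axiom [C3]: for all x, y ∈ E and f ∈ R, [x, f • y] = f • [x, y] + (ρ(x) f) • y − (B x y) • D f. (This is Proposition 1(i).) -/
/-- Proposition 1(i): Under axiom [C5] and the Leibniz rule (L), the bracket
satisfies axiom [C3]. -/
theorem courant_C5_L_implies_C3
    {R E : Type*} [CommRing R] [Algebra ℝ R]
    [AddCommGroup E] [Module ℝ E] [Module R E] [IsScalarTower ℝ R E]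
    (B : E →ₗ[R] E →ₗ[R] R)
    (hBsymm : ∀ x y : E, B x y = B y x)
    (hBnd : ∀ x : E, (∀ y : E, B x y = 0) → x = 0)
    (ρ : E →ₗ[R] Derivation ℝ R R)
    (br : E →ₗ[ℝ] E →ₗ[ℝ] E)
    (D : R →ₗ[ℝ] E)
    (hC5 : ∀ x y z : E,
      ρ x (B y z) = B (br x y + D (B x y)) z + B y (br x z + D (B x z)))
    (hL : ∀ f g : R, D (f * g) = f • D g + g • D f) :
    ∀ (x y : E) (f : R),
      br x (f • y) = f • br x y + (ρ x f) • y - (B x y) • D f := by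
  intro x y f
  refine sub_eq_zero.mp (hBnd _ fun z => ?_)
  have hfy := hC5 x (f • y) z
  have hy := hC5 x y z
  simp only [map_smul, map_add, LinearMap.smul_apply, LinearMap.add_apply, smul_eq_mul, hL,
    Derivation.leibniz] at hfy hy
  simp only [map_smul, map_add, map_sub, LinearMap.smul_apply, LinearMap.add_apply,
    LinearMap.sub_apply, smul_eq_mul]
  linear_combination f * hy - hfy
end

section
/- Under axioms [C2], [C5] and the Leibniz rule (L), and assuming the pairing represents 1 (there exist e, e' ∈ E with B e e' = 1), axiom [C4] holds: ρ ∘ D = 0, i.e., ρ(D f) = 0 as a derivation of R, for every f ∈ R. (This is Proposition 1(ii).) -/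
/-- Proposition 1(ii): Under axioms [C2], [C5] and the Leibniz rule (L), and
assuming the pairing represents 1, axiom [C4] holds: ρ ∘ D = 0. -/
theorem courant_C2_C5_L_implies_C4
    {R E : Type*} [CommRing R] [Algebra ℝ R]
    [AddCommGroup E] [Module ℝ E] [Module R E] [IsScalarTower ℝ R E]
    (B : E →ₗ[R] E →ₗ[R] R)
    (hBsymm : ∀ x y : E, B x y = B y x)
    (hBnd : ∀ x : E, (∀ y : E, B x y = 0) → x = 0)
    (ρ : E →ₗ[R] Derivation ℝ R R)
    (br : E →ₗ[ℝ] E →ₗ[ℝ] E)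
    (D : R →ₗ[ℝ] E)
    (hC2 : ∀ (x y : E) (f : R), ρ (br x y) f = ρ x (ρ y f) - ρ y (ρ x f))
    (hC5 : ∀ x y z : E,
      ρ x (B y z) = B (br x y + D (B x y)) z + B y (br x z + D (B x z)))
    (hL : ∀ f g : R, D (f * g) = f • D g + g • D f)
    (hone : ∃ e e' : E, B e e' = 1) :
    ∀ f : R, ρ (D f) = 0 := by
  obtain ⟨e, e', he⟩ := hone
  intro f
  have bracket_smul : br e (f • e') = f • br e e' + ρ e f • e' - D f := by
    rw [← sub_eq_zero]
    refine hBnd _ fun z => ?_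
    have h₁ := hC5 e (f • e') z
    have h₂ := hC5 e e' z
    simp only [map_add, map_sub, map_smul, LinearMap.add_apply, LinearMap.sub_apply,
      LinearMap.smul_apply, smul_eq_mul, Derivation.leibniz, he, hL] at h₁ h₂ ⊢
    linear_combination f * h₂ - h₁
  ext g
  have h₁ := hC2 e (f • e') g
  have h₂ := hC2 e e' g
  rw [bracket_smul] at h₁
  simp only [map_add, map_sub, map_smul, Derivation.add_apply, Derivation.sub_apply,
    Derivation.smul_apply, smul_eq_mul, Derivation.leibniz] at h₁
  rw [Derivation.zero_apply]
  linear_combination f * h₂ - h₁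
end

section
/- Conversely, if a map D : R → E satisfies the identity of axiom [C3], namely [x, f • y] = f • [x, y] + (ρ(x) f) • y − (B x y) • D f for all x, y ∈ E and f ∈ R, and if the pairing represents 1 (there exist e, e' ∈ E with B e e' = 1), then D satisfies the Leibniz rule: D(f·g) = f • D g + g • D f for all f, g ∈ R. (This is Remark 2.1.) -/
/-- Remark 2.1: if `D` satisfies the identity of axiom [C3] and the pairing
represents 1, then `D` satisfies the Leibniz rule (L). -/
theorem courant_C3_implies_Leibniz
    {R E : Type*} [CommRing R] [Algebra ℝ R]
    [AddCommGroup E] [Module ℝ E] [Module R E] [IsScalarTower ℝ R E]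
    (B : E →ₗ[R] E →ₗ[R] R)
    (hBsymm : ∀ x y : E, B x y = B y x)
    (hBnd : ∀ x : E, (∀ y : E, B x y = 0) → x = 0)
    (ρ : E →ₗ[R] Derivation ℝ R R)
    (br : E →ₗ[ℝ] E →ₗ[ℝ] E)
    (D : R →ₗ[ℝ] E)
    (hC3 : ∀ (x y : E) (f : R),
      br x (f • y) = f • br x y + (ρ x f) • y - (B x y) • D f)
    (hone : ∃ e e' : E, B e e' = 1) :
    ∀ f g : R, D (f * g) = f • D g + g • D f := by
  intro f g
  obtain ⟨e, e', he⟩ := hone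
  have h := hC3 e e' (f * g)
  rw [mul_smul, hC3 e (g • e') f, hC3 e e' g, map_smul, he, Derivation.leibniz] at h
  simp only [smul_eq_mul, mul_one, one_smul] at h
  linear_combination (norm := module) h
end

section
/- Assume axioms [C5], the Leibniz rule (L), that the bracket [·,·] is skew-symmetric, and that E has no zero scalar-multiplication divisors (c • y = 0 implies c = 0 or y = 0). If [x, D f] = D(B x (D f)) holds for all x ∈ E and f ∈ R, then axiom [C2] holds: ρ [x,y] = ρ x ∘ ρ y − ρ y ∘ ρ x (commutator of derivations) for all x, y ∈ E. (This is one direction of the equivalence in Remark 2.2.) -/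
/-- One direction of the equivalence in Remark 2.2: under [C5], (L),
skew-symmetry of the bracket and absence of zero scalar-multiplication
divisors, if `[x, D f] = D (B x (D f))` for all `x, f`, then [C2] holds. -/
theorem courant_bracket_D_implies_C2
    {R E : Type*} [CommRing R] [Algebra ℝ R]
    [AddCommGroup E] [Module ℝ E] [Module R E] [IsScalarTower ℝ R E]
    (B : E →ₗ[R] E →ₗ[R] R)
    (hBsymm : ∀ x y : E, B x y = B y x)
    (hBnd : ∀ x : E, (∀ y : E, B x y = 0) → x = 0)
    (ρ : E →ₗ[R] Derivation ℝ R R)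
    (br : E →ₗ[ℝ] E →ₗ[ℝ] E)
    (hskew : ∀ x y : E, br x y = - br y x)
    (D : R →ₗ[ℝ] E)
    (hC5 : ∀ x y z : E,
      ρ x (B y z) = B (br x y + D (B x y)) z + B y (br x z + D (B x z)))
    (hL : ∀ f g : R, D (f * g) = f • D g + g • D f)
    (hnzd : ∀ (c : R) (y : E), c • y = 0 → c = 0 ∨ y = 0)
    (hDf : ∀ (x : E) (f : R), br x (D f) = D (B x (D f))) :
    ∀ (x y : E) (f : R), ρ (br x y) f = ρ x (ρ y f) - ρ y (ρ x f) := by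
  have cancel_two (c : R) (hc : c + c = 0) : c = 0 := by
    have h : (2 : ℝ) • c = 0 := by rw [two_smul, hc]
    simpa [smul_smul] using congrArg ((2⁻¹ : ℝ) • ·) h
  have br_smul (x y : E) (f : R) : br x (f • y) = f • br x y + ρ x f • y - B x y • D f := by
    rw [← sub_eq_zero]
    refine hBnd _ fun z ↦ ?_
    have h := hC5 x (f • y) z
    have h' := hC5 x y z
    simp only [map_smul, map_add, LinearMap.smul_apply, LinearMap.add_apply, smul_eq_mul,
      Derivation.leibniz, hL] at h h'
    simp only [map_smul, map_add, map_sub, LinearMap.smul_apply, LinearMap.add_apply,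
      LinearMap.sub_apply, smul_eq_mul]
    linear_combination -h + f * h'
  have smul_br (x y : E) (f : R) : br (f • x) y = f • br x y - ρ y f • x + B x y • D f := by
    rw [hskew, br_smul, hskew y x, hBsymm y x]
    module
  -- The form `B` identifies `2 • D f` with `y ↦ ρ y f`.
  have anchor_eq (y : E) (f : R) : ρ y f = B y (D f) + B y (D f) := by
    have h : (ρ y f - (B y (D f) + B y (D f)) + (ρ y f - (B y (D f) + B y (D f)))) • y = 0 := by
      refine hBnd _ fun x ↦ ?_
      have h := hC5 (f • x) y y
      have h' := hC5 x y y
      simp only [map_smul, map_add, LinearMap.smul_apply, LinearMap.add_apply, smul_eq_mul,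
        LinearMap.sub_apply, map_sub, smul_br, Derivation.smul_apply, hL] at h h'
      simp only [map_smul, LinearMap.smul_apply, smul_eq_mul]
      rw [hBsymm (D f) y, hBsymm x y] at h
      rw [hBsymm x y] at h'
      linear_combination h - f * h'
    rcases hnzd _ _ h with h | rfl
    · exact sub_eq_zero.mp (cancel_two _ h)
    · simp
  have anchor_br (x y : E) (f : R) :
      ρ x (ρ y f) = ρ (br x y) f + ρ (D (B x y)) f + ρ y (ρ x f) := by
    have h := hC5 x y (D f)
    rw [hDf, ← map_add D, ← anchor_eq, map_add B, LinearMap.add_apply] at h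
    rw [anchor_eq y f, map_add, h, anchor_eq (br x y), anchor_eq (D (B x y)),
      anchor_eq y (ρ x f)]
    ring
  intro x y f
  have h := anchor_br x y f
  have h' := anchor_br y x f
  rw [hskew y x, hBsymm y x, map_neg, Derivation.neg_apply] at h'
  have h₀ := cancel_two (ρ (D (B x y)) f) (by linear_combination -h - h')
  linear_combination -h - h₀
end

section
/- In the non-skew-symmetric (Dorfman) setting, axiom [C'5] alone implies axiom [C'3]: for all x, y ∈ E and f ∈ R, x ∘ (f • y) = f • (x ∘ y) + (ρ(x) f) • y. (This is part of the claim of Remark 2.3.) -/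
/-- Remark 2.3 (part): in the Dorfman setting, axiom [C'5] alone implies
axiom [C'3]: `x ∘ (f • y) = f • (x ∘ y) + (ρ(x) f) • y`. -/
theorem dorfman_C5'_implies_C3'
    {R E : Type*} [CommRing R] [Algebra ℝ R]
    [AddCommGroup E] [Module ℝ E] [Module R E] [IsScalarTower ℝ R E]
    (B : E →ₗ[R] E →ₗ[R] R)
    (hBsymm : ∀ x y : E, B x y = B y x)
    (hBnd : ∀ x : E, (∀ y : E, B x y = 0) → x = 0)
    (ρ : E →ₗ[R] Derivation ℝ R R)
    (circ : E →ₗ[ℝ] E →ₗ[ℝ] E)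
    (D : R →ₗ[ℝ] E)
    (hC5' : ∀ x y z : E, ρ x (B y z) = B (circ x y) z + B y (circ x z)) :
    ∀ (x y : E) (f : R), circ x (f • y) = f • circ x y + (ρ x f) • y := by
  intro x y f
  refine sub_eq_zero.mp (hBnd _ fun z => ?_)
  have hfy := hC5' x (f • y) z
  have hy := hC5' x y z
  simp only [map_smul, LinearMap.smul_apply, smul_eq_mul, Derivation.leibniz] at hfy
  simp only [map_sub, map_add, map_smul, LinearMap.sub_apply, LinearMap.add_apply,
    LinearMap.smul_apply, smul_eq_mul]
  linear_combination f * hy - hfy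
end

section
/- In the non-skew-symmetric (Dorfman) setting, assume axioms [C'4], [C'5], the Leibniz rule (L), and that E has no zero scalar-multiplication divisors (c • y = 0 implies c = 0 or y = 0). Then D satisfies D = (1/2)β⁻¹ρ*d in the sense that B (D f) y = (1/2) · ρ(y) f for all y ∈ E and f ∈ R. (This is part of the claim of Remark 2.3.) -/
/-- Remark 2.3 (part): in the Dorfman setting, under [C'4], [C'5], (L), and
absence of zero scalar-multiplication divisors, `B (D f) y = (1/2) • ρ y f`. -/
theorem dorfman_D_eq_half_rho
    {R E : Type*} [CommRing R] [Algebra ℝ R]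
    [AddCommGroup E] [Module ℝ E] [Module R E] [IsScalarTower ℝ R E]
    (B : E →ₗ[R] E →ₗ[R] R)
    (hBsymm : ∀ x y : E, B x y = B y x)
    (hBnd : ∀ x : E, (∀ y : E, B x y = 0) → x = 0)
    (ρ : E →ₗ[R] Derivation ℝ R R)
    (circ : E →ₗ[ℝ] E →ₗ[ℝ] E)
    (D : R →ₗ[ℝ] E)
    (hC4' : ∀ x : E, circ x x = D (B x x))
    (hC5' : ∀ x y z : E, ρ x (B y z) = B (circ x y) z + B y (circ x z))
    (hL : ∀ f g : R, D (f * g) = f • D g + g • D f)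
    (hnzd : ∀ (c : R) (y : E), c • y = 0 → c = 0 ∨ y = 0) :
    ∀ (y : E) (f : R), B (D f) y = (1/2 : ℝ) • ρ y f := by
  -- `circ` satisfies a Leibniz rule in each argument; the left one has a correction by `D`.
  have circ_smul (x y : E) (f : R) : circ x (f • y) = f • circ x y + ρ x f • y := by
    rw [← sub_eq_zero]
    refine hBnd _ fun z => ?_
    have h₁ := hC5' x (f • y) z
    have h₂ := hC5' x y z
    simp only [map_smul, LinearMap.smul_apply, smul_eq_mul, Derivation.leibniz, map_sub, map_add,
      LinearMap.sub_apply, LinearMap.add_apply] at h₁ ⊢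
    linear_combination f * h₂ - h₁
  have circ_add_swap (x y : E) : circ x y + circ y x = D (B x y) + D (B x y) := by
    have h := hC4' (x + y)
    simp only [map_add, LinearMap.add_apply, hC4', hBsymm y x] at h
    rw [← sub_eq_zero] at h ⊢
    rw [← h]
    abel
  have smul_circ (x y : E) (f : R) :
      circ (f • x) y = f • circ x y + (2 * B x y) • D f - ρ y f • x := by
    have h₁ := circ_add_swap (f • x) y
    simp only [circ_smul, map_smul, LinearMap.smul_apply, smul_eq_mul, hL] at h₁
    linear_combination (norm := module) h₁ - f • circ_add_swap x y
  intro y f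
  have hy : (2 * B (D f) y - ρ y f) • y = 0 := by
    refine hBnd _ fun x => ?_
    have h₁ := hC5' (f • x) y y
    have h₂ := hC5' x y y
    simp only [smul_circ, map_smul, LinearMap.smul_apply, Derivation.smul_apply, smul_eq_mul,
      map_sub, map_add, LinearMap.sub_apply, LinearMap.add_apply, hBsymm y] at h₁ h₂ ⊢
    have h₃ : (2 : ℝ) • ((2 * B (D f) y - ρ y f) * B x y) = 0 := by
      rw [two_smul]
      linear_combination f * h₂ - h₁
    exact (smul_eq_zero_iff_right two_ne_zero).mp h₃
  have ha : 2 * B (D f) y - ρ y f = 0 := by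
    rcases hnzd _ _ hy with h | rfl
    · exact h
    · simp
  rw [← sub_eq_zero.mp ha, two_mul, ← two_smul ℝ, smul_smul]
  norm_num
end

section
/- In the non-skew-symmetric (Dorfman) setting, assume axioms [C'1], [C'5], the Leibniz rule (L), and that E is a faithful R-module in the sense that if c • w = 0 for all w ∈ E then c = 0. Then axiom [C'2] holds: for all x, y ∈ E, ρ(x ∘ y) = ρ x ∘ ρ y − ρ y ∘ ρ x (commutator of derivations). (This is part of the claim of Remark 2.3.) -/
/-- An operation compatible with a nondegenerate form through derivations `ρ x` satisfies the
Leibniz rule in its second argument. -/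
theorem dorfman_leibniz_right
    {R E : Type*} [CommRing R] [Algebra ℝ R] [AddCommGroup E] [Module R E]
    (B : E →ₗ[R] E →ₗ[R] R)
    (hBnd : ∀ x : E, (∀ y : E, B x y = 0) → x = 0)
    (ρ : E → Derivation ℝ R R) (circ : E → E → E)
    (hcompat : ∀ x y z : E, ρ x (B y z) = B (circ x y) z + B y (circ x z))
    (x z : E) (f : R) :
    circ x (f • z) = f • circ x z + ρ x f • z := by
  refine sub_eq_zero.mp (hBnd _ fun w => ?_)
  have hfz := hcompat x (f • z) w
  have hz := hcompat x z w
  simp only [map_smul, LinearMap.smul_apply, smul_eq_mul, Derivation.leibniz] at hfz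
  simp only [map_sub, map_add, map_smul, LinearMap.sub_apply, LinearMap.add_apply,
    LinearMap.smul_apply, smul_eq_mul]
  linear_combination f * hz - hfz

/-- Remark 2.3 (part): in the Dorfman setting, under [C'1], [C'5], (L), and
faithfulness of the R-module E, axiom [C'2] holds. -/
theorem dorfman_C1'_C5'_implies_C2'
    {R E : Type*} [CommRing R] [Algebra ℝ R]
    [AddCommGroup E] [Module ℝ E] [Module R E] [IsScalarTower ℝ R E]
    (B : E →ₗ[R] E →ₗ[R] R)
    (hBsymm : ∀ x y : E, B x y = B y x)
    (hBnd : ∀ x : E, (∀ y : E, B x y = 0) → x = 0)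
    (ρ : E →ₗ[R] Derivation ℝ R R)
    (circ : E →ₗ[ℝ] E →ₗ[ℝ] E)
    (D : R →ₗ[ℝ] E)
    (hC1' : ∀ x y z : E, circ x (circ y z) = circ (circ x y) z + circ y (circ x z))
    (hC5' : ∀ x y z : E, ρ x (B y z) = B (circ x y) z + B y (circ x z))
    (hL : ∀ f g : R, D (f * g) = f • D g + g • D f)
    (hfaithful : ∀ c : R, (∀ w : E, c • w = 0) → c = 0) :
    ∀ (x y : E) (f : R), ρ (circ x y) f = ρ x (ρ y f) - ρ y (ρ x f) := by
  have leib := dorfman_leibniz_right B hBnd ρ (fun x y => circ x y) hC5'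
  intro x y f
  refine sub_eq_zero.mp (hfaithful _ fun w => ?_)
  have hfw := hC1' x y (f • w)
  simp only [leib, map_add] at hfw
  linear_combination (norm := module) f • hC1' x y w - hfw
end
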